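/- Let c denote the closed subspace of ℓ∞ consisting of all convergent real sequences, equipped with the supremum norm. For every infinite-dimensional reflexive real Banach space X there exist bounded linear operators S, R : X → c such that R has rank at most one, ‖S + R‖ > ‖S‖, and S + R does not attain its norm. In particular, the pair (X, c) fails the compact perturbation property. -/

import Mathlib

open Filter Topology
open scoped ENNReal

/-- A bounded linear operator attains its norm if `‖T x‖ = ‖T‖` for some `x` in the
closed unit ball. -/
def NormAttains {X Y : Type*} [NormedAddCommGroup X] [NormedSpace ℝ X]
    [NormedAddCommGroup Y] [NormedSpace ℝ Y] (T : X →L[ℝ] Y) : Prop :=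
  ∃ x : X, ‖x‖ ≤ 1 ∧ ‖T x‖ = ‖T‖

/-- The pair `(X, Y)` has the compact perturbation property. -/
def CPP (X Y : Type*) [NormedAddCommGroup X] [NormedSpace ℝ X]
    [NormedAddCommGroup Y] [NormedSpace ℝ Y] : Prop :=
  ∀ T K : X →L[ℝ] Y, IsCompactOperator ⇑K → ‖T‖ < ‖T + K‖ → NormAttains (T + K)

/-- A normed space is reflexive if the canonical embedding into the bidual is surjective. -/
def IsReflexiveSpace (X : Type*) [NormedAddCommGroup X] [NormedSpace ℝ X] : Prop :=
  Function.Surjective (NormedSpace.inclusionInDoubleDual ℝ X)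

/-- The subspace `c` of `ℓ∞` consisting of the convergent sequences. -/
noncomputable def spaceC : Submodule ℝ (lp (fun _ : ℕ => ℝ) ∞) where
  carrier := {x | ∃ l : ℝ, Tendsto (fun n => x n) atTop (nhds l)}
  add_mem' := by
    rintro a b ⟨la, ha⟩ ⟨lb, hb⟩
    exact ⟨la + lb, by simpa [lp.coeFn_add] using ha.add hb⟩
  zero_mem' := ⟨0, by simp [lp.coeFn_zero]⟩
  smul_mem' := by
    rintro r a ⟨la, ha⟩
    exact ⟨r * la, by simpa [lp.coeFn_smul] using ha.const_mul r⟩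

/-- In the dual of a reflexive space, norm-closed subspaces are weak-* closed. -/
theorem IsReflexiveSpace.isClosed_preimage_toStrongDual {X : Type*} [NormedAddCommGroup X]
    [NormedSpace ℝ X] (hrefl : IsReflexiveSpace X) (W : Submodule ℝ (StrongDual ℝ X))
    (hW : IsClosed (W : Set (StrongDual ℝ X))) :
    IsClosed ((WeakDual.toStrongDual : WeakDual ℝ X → StrongDual ℝ X) ⁻¹' W) := by
  have key : (WeakDual.toStrongDual : WeakDual ℝ X → StrongDual ℝ X) ⁻¹' W =
      ⋂ x ∈ {x : X | ∀ g ∈ W, g x = 0}, {φ : WeakDual ℝ X | φ x = 0} := by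
    ext φ
    simp only [Set.mem_preimage, SetLike.mem_coe, Set.mem_iInter, Set.mem_ofPred_eq]
    refine ⟨fun h x hx => hx _ h, fun h => ?_⟩
    by_contra hφ
    obtain ⟨F, u, hFu, hF⟩ := geometric_hahn_banach_point_closed W.convex hW hφ
    obtain ⟨x, rfl⟩ := hrefl F
    have hzero : ∀ g ∈ W, g x = 0 := by
      intro g hg
      by_contra hne
      have := hF ((u / g x) • g) (W.smul_mem _ hg)
      simp [div_mul_cancel₀ _ hne] at this
    have h0 := hF 0 W.zero_mem
    have h1 : φ x < u := hFu
    rw [h x hzero] at h1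
    simp at h0
    linarith
  rw [key]
  exact isClosed_biInter fun x _ =>
    isClosed_singleton.preimage (WeakDual.eval_continuous x)

/-- A separable set of functionals admits a countable family of vectors detecting which of its
members vanish. -/
theorem TopologicalSpace.IsSeparable.exists_seq_separating {X : Type*} [NormedAddCommGroup X]
    [NormedSpace ℝ X] {W : Set (StrongDual ℝ X)} (hW : TopologicalSpace.IsSeparable W) :
    ∃ d : ℕ → X, ∀ f ∈ W, (∀ n, f (d n) = 0) → f = 0 := by
  obtain ⟨c, hc, hWc⟩ := hW
  rcases c.eq_empty_or_nonempty with rfl | hne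
  · exact ⟨0, fun f hf => by simpa using hWc hf⟩
  obtain ⟨v, rfl⟩ := hc.exists_eq_range hne
  have hd : ∀ n, ∃ x : X, ‖x‖ ≤ 1 ∧ ‖v n‖ / 2 ≤ ‖v n x‖ := by
    intro n
    rcases eq_or_ne (v n) 0 with h | h
    · exact ⟨0, by simp [h]⟩
    · obtain ⟨x, hx, hx'⟩ := (v n).exists_lt_apply_of_lt_opNorm
        (half_lt_self (norm_pos_iff.2 h))
      exact ⟨x, hx.le, hx'.le⟩
  choose d hd1 hd2 using hd
  refine ⟨d, fun f hf h0 => ?_⟩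
  by_contra hne
  have hpos := norm_pos_iff.2 hne
  obtain ⟨_, ⟨n, rfl⟩, hn⟩ := Metric.mem_closure_iff.1 (hWc hf) (‖f‖ / 4) (by positivity)
  rw [dist_eq_norm] at hn
  have h1 : ‖v n (d n)‖ ≤ ‖f - v n‖ := by
    have := (f - v n).le_of_opNorm_le_of_le le_rfl (hd1 n)
    simpa [h0 n] using this
  have h2 := norm_sub_norm_le f (v n)
  linarith [hd2 n]

/-- The ball of radius `r` of a subspace of the dual, with the weak-* topology. -/
def dualBall {X : Type*} [NormedAddCommGroup X] [NormedSpace ℝ X]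
    (W : Submodule ℝ (StrongDual ℝ X)) (r : ℝ) : Set (WeakDual ℝ X) :=
  WeakDual.toStrongDual ⁻¹' W ∩ WeakDual.toStrongDual ⁻¹' Metric.closedBall 0 r

theorem IsReflexiveSpace.isCompact_dualBall {X : Type*} [NormedAddCommGroup X] [NormedSpace ℝ X]
    (hrefl : IsReflexiveSpace X) {W : Submodule ℝ (StrongDual ℝ X)}
    (hW : IsClosed (W : Set (StrongDual ℝ X))) (r : ℝ) : IsCompact (dualBall W r) :=
  (WeakDual.isCompact_closedBall 0 r).inter_left (hrefl.isClosed_preimage_toStrongDual W hW)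

theorem metrizableSpace_dualBall {X : Type*} [NormedAddCommGroup X] [NormedSpace ℝ X]
    {W : Submodule ℝ (StrongDual ℝ X)} {r : ℝ} (hK : IsCompact (dualBall W r))
    (hsep : TopologicalSpace.IsSeparable (W : Set (StrongDual ℝ X))) :
    TopologicalSpace.MetrizableSpace (dualBall W r) := by
  have : CompactSpace (dualBall W r) := isCompact_iff_compactSpace.mp hK
  obtain ⟨d, hd⟩ := hsep.exists_seq_separating
  refine Metric.PiNatEmbed.TopologicalSpace.MetrizableSpace.of_countable_separating
    (fun n (k : dualBall W r) => k.1 (d n))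
    (fun n => (WeakDual.eval_continuous _).comp continuous_subtype_val) fun x y hxy => ?_
  contrapose! hxy
  have := hd _ (W.sub_mem x.2.1 y.2.1) fun n => sub_eq_zero.2 (hxy n)
  exact Subtype.ext (sub_eq_zero.1 this)

/-- A `1`-separated bounded sequence in a separable closed subspace of the dual of a reflexive
space gives rise to a normalized weak-* null sequence in that subspace. -/
theorem IsReflexiveSpace.exists_normalized_null_seq {X : Type*} [NormedAddCommGroup X]
    [NormedSpace ℝ X] (hrefl : IsReflexiveSpace X) {W : Submodule ℝ (StrongDual ℝ X)}
    (hW : IsClosed (W : Set (StrongDual ℝ X)))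
    (hsep : TopologicalSpace.IsSeparable (W : Set (StrongDual ℝ X)))
    {r : ℝ} {φ : ℕ → StrongDual ℝ X} (hφW : ∀ n, φ n ∈ W) (hφr : ∀ n, ‖φ n‖ ≤ r)
    (hφ : Pairwise fun m n => 1 ≤ ‖φ m - φ n‖) :
    ∃ e : ℕ → StrongDual ℝ X, (∀ n, e n ∈ W) ∧ (∀ n, ‖e n‖ = 1) ∧
      ∀ x, Tendsto (fun n => e n x) atTop (𝓝 0) := by
  have hK := hrefl.isCompact_dualBall hW r
  have := metrizableSpace_dualBall hK hsep
  have : CompactSpace (dualBall W r) := isCompact_iff_compactSpace.mp hK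
  obtain ⟨a, s, hs, ha⟩ := SeqCompactSpace.tendsto_subseq (X := dualBall W r)
    fun n => ⟨StrongDual.toWeakDual (φ n), hφW n, by simpa using hφr n⟩
  set α : StrongDual ℝ X := WeakDual.toStrongDual a.1
  have hlim : ∀ x, Tendsto (fun n => φ (s n) x) atTop (𝓝 (α x)) := fun x =>
    (((WeakDual.eval_continuous x).comp continuous_subtype_val).tendsto a).comp ha
  obtain ⟨N, hN⟩ : ∃ N, ∀ n ≥ N, 1 / 2 ≤ ‖φ (s n) - α‖ := by
    by_cases h : ∃ m, ‖φ (s m) - α‖ < 1 / 2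
    · obtain ⟨m, hm⟩ := h
      refine ⟨m + 1, fun n hn => ?_⟩
      have h1 := hφ (hs (Nat.lt_of_succ_le hn)).ne
      have h2 := norm_sub_le (φ (s m) - α) (φ (s n) - α)
      rw [sub_sub_sub_cancel_right] at h2
      simp only at h1
      linarith
    · push Not at h
      exact ⟨0, fun n _ => h n⟩
  refine ⟨fun n => ‖φ (s (n + N)) - α‖⁻¹ • (φ (s (n + N)) - α),
    fun n => W.smul_mem _ (W.sub_mem (hφW _) a.2.1), fun n => ?_, fun x => ?_⟩
  · have := hN (n + N) (by omega)
    rw [norm_smul, norm_inv, norm_norm, inv_mul_cancel₀ (by linarith)]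
  · have h0 : Tendsto (fun n => φ (s (n + N)) x - α x) atTop (𝓝 0) := by
      simpa using ((tendsto_add_atTop_iff_nat N).2 (hlim x)).sub_const (α x)
    refine squeeze_zero_norm (fun n => ?_) (by simpa using h0.norm.const_mul 2)
    have h1 := hN (n + N) (by omega)
    simp only [smul_apply, sub_apply, norm_smul, norm_inv, norm_norm]
    refine mul_le_mul_of_nonneg_right ?_ (norm_nonneg _)
    rw [inv_le_comm₀ (by linarith) (by norm_num)]
    linarith

/-- The unit ball of a separable closed subspace of the dual of a reflexive space has a point near
which the weak-* topology controls the norm up to `1 / 2`. -/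
theorem IsReflexiveSpace.exists_weak_norm_point {X : Type*} [NormedAddCommGroup X]
    [NormedSpace ℝ X] (hrefl : IsReflexiveSpace X) {W : Submodule ℝ (StrongDual ℝ X)}
    (hW : IsClosed (W : Set (StrongDual ℝ X)))
    (hsep : TopologicalSpace.IsSeparable (W : Set (StrongDual ℝ X))) :
    ∃ f ∈ W, ‖f‖ ≤ 1 ∧ ∀ g : ℕ → StrongDual ℝ X, (∀ n, g n ∈ W) → (∀ n, ‖g n‖ ≤ 1) →
      (∀ x, Tendsto (fun n => g n x) atTop (𝓝 (f x))) → ∀ᶠ n in atTop, ‖g n - f‖ ≤ 1 / 2 := by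
  have hK := hrefl.isCompact_dualBall hW 1
  have : CompactSpace (dualBall W 1) := isCompact_iff_compactSpace.mp hK
  have : Nonempty (dualBall W 1) := ⟨0, W.zero_mem, by simp⟩
  obtain ⟨c, hc, hWc⟩ := hsep
  have : Countable c := hc
  obtain ⟨v, ⟨a, ha⟩⟩ := nonempty_interior_of_iUnion_of_closed
    (f := fun v : c => {k : dualBall W 1 |
      WeakDual.toStrongDual k.1 ∈ Metric.closedBall v.1 (1 / 4)})
    (fun v => (WeakDual.isClosed_closedBall v.1 (1 / 4)).preimage continuous_subtype_val) (by
      refine Set.eq_univ_of_forall fun k => ?_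
      obtain ⟨v, hv, hkv⟩ := Metric.mem_closure_iff.1 (hWc k.2.1) (1 / 4) (by norm_num)
      exact Set.mem_iUnion.2 ⟨⟨v, hv⟩, hkv.le⟩)
  refine ⟨WeakDual.toStrongDual a.1, a.2.1, by simpa using a.2.2, fun g hgW hg1 hg => ?_⟩
  have hlim : Tendsto (fun n => (⟨StrongDual.toWeakDual (g n), hgW n, by simpa using hg1 n⟩ :
      dualBall W 1)) atTop (𝓝 a) := by
    rw [tendsto_subtype_rng]
    exact tendsto_iff_forall_eval_tendsto_topDualPairing.2 hg
  filter_upwards [hlim (isOpen_interior.mem_nhds ha)] with n hn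
  replace hn := interior_subset hn
  replace ha := interior_subset ha
  have h1 : dist (g n) v.1 ≤ 1 / 4 := hn
  have h2 : dist (WeakDual.toStrongDual a.1) v.1 ≤ 1 / 4 := ha
  rw [← dist_eq_norm]
  linarith [dist_triangle_right (g n) (WeakDual.toStrongDual a.1) v.1]

/-- The dual of an infinite-dimensional reflexive space contains a point `f` of the unit ball and a
normalized weak-* null sequence `e` such that `‖f + e n‖` stays above `1` and converges. -/
theorem IsReflexiveSpace.exists_add_null_seq {X : Type*} [NormedAddCommGroup X] [NormedSpace ℝ X]
    (hinf : ¬ FiniteDimensional ℝ X) (hrefl : IsReflexiveSpace X) :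
    ∃ (f : StrongDual ℝ X) (e : ℕ → StrongDual ℝ X) (q L : ℝ), ‖f‖ ≤ 1 ∧ (∀ n, ‖e n‖ = 1) ∧
      (∀ x, Tendsto (fun n => e n x) atTop (𝓝 0)) ∧ 1 < q ∧ (∀ n, q ≤ ‖f + e n‖) ∧
      Tendsto (fun n => ‖f + e n‖) atTop (𝓝 L) := by
  have hinf' : ¬ FiniteDimensional ℝ (StrongDual ℝ X) := fun h => hinf <|
    FiniteDimensional.of_injective
      (NormedSpace.inclusionInDoubleDual ℝ X : X →ₗ[ℝ] StrongDual ℝ (StrongDual ℝ X))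
      (NormedSpace.inclusionInDoubleDualLi ℝ (E := X)).injective
  obtain ⟨r, φ, -, hφr, hφ⟩ := exists_seq_norm_le_one_le_norm_sub (𝕜 := ℝ) hinf'
  set W := (Submodule.span ℝ (Set.range φ)).topologicalClosure
  have hW : IsClosed (W : Set (StrongDual ℝ X)) := Submodule.isClosed_topologicalClosure _
  have hsep : TopologicalSpace.IsSeparable (W : Set (StrongDual ℝ X)) :=
    ((Set.countable_range φ).isSeparable.span (R := ℝ)).closure
  have hφW : ∀ n, φ n ∈ W := fun n =>
    Submodule.le_topologicalClosure _ (Submodule.subset_span ⟨n, rfl⟩)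
  obtain ⟨e, heW, he1, he0⟩ := hrefl.exists_normalized_null_seq hW hsep hφW hφr hφ
  obtain ⟨f, hfW, hf1, hf⟩ := hrefl.exists_weak_norm_point hW hsep
  obtain ⟨q, hq, hfreq⟩ : ∃ q : ℝ, 1 < q ∧ ∃ᶠ n in atTop, q ≤ ‖f + e n‖ := by
    by_contra! hcon
    set t : ℕ → ℝ := fun n => max 1 ‖f + e n‖
    have ht1 : ∀ n, 1 ≤ t n := fun n => le_max_left _ _
    have ht : Tendsto t atTop (𝓝 1) := by
      rw [Metric.tendsto_nhds]
      intro ε hε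
      filter_upwards [hcon (1 + ε) (by linarith)] with n hn
      have : t n < 1 + ε := max_lt (by linarith) hn
      rw [Real.dist_eq, abs_of_nonneg (by linarith [ht1 n])]
      linarith
    have htinv : Tendsto (fun n => (t n)⁻¹) atTop (𝓝 1) := by
      simpa using ht.inv₀ one_ne_zero
    have hev := hf (fun n => (t n)⁻¹ • (f + e n)) (fun n => W.smul_mem _ (W.add_mem hfW (heW n)))
      (fun n => by
        rw [norm_smul, norm_inv, Real.norm_of_nonneg (by linarith [ht1 n]),
          inv_mul_le_one₀ (by linarith [ht1 n])]
        exact le_max_right _ _)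
      (fun x => by
        have := htinv.mul ((he0 x).const_add (f x))
        simpa [mul_add] using this)
    have hsmall : ∀ᶠ n in atTop, |(t n)⁻¹ - 1| < 1 / 8 := by
      have := Metric.tendsto_nhds.1 htinv (1 / 8) (by norm_num)
      simpa only [Real.dist_eq] using this
    obtain ⟨n, hn1, hn2⟩ := (hev.and hsmall).exists
    have hid : e n = ((t n)⁻¹ • (f + e n) - f) - ((t n)⁻¹ - 1) • (f + e n) := by module
    have h3 : ‖f + e n‖ ≤ 2 := (norm_add_le _ _).trans (by linarith [he1 n])
    have h4 := norm_sub_le ((t n)⁻¹ • (f + e n) - f) (((t n)⁻¹ - 1) • (f + e n))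
    rw [← hid, he1, norm_smul, Real.norm_eq_abs] at h4
    have h5 : |(t n)⁻¹ - 1| * ‖f + e n‖ ≤ 1 / 8 * 2 := by gcongr
    linarith
  obtain ⟨s, hs, hsq⟩ := extraction_of_frequently_atTop hfreq
  obtain ⟨L, -, p, hp, hL⟩ := (isCompact_Icc (a := (0 : ℝ)) (b := 2)).tendsto_subseq
    (x := fun n => ‖f + e (s n)‖)
    fun n => ⟨norm_nonneg _, (norm_add_le _ _).trans (by linarith [he1 (s n)])⟩
  exact ⟨f, fun n => e (s (p n)), q, L, hf1, fun n => he1 _,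
    fun x => (he0 x).comp (hs.comp hp).tendsto_atTop, hq, fun n => hsq _, hL⟩

/-- A bounded pointwise convergent sequence of functionals defines an operator into `c`. -/
theorem exists_clm_spaceC {X : Type*} [NormedAddCommGroup X] [NormedSpace ℝ X]
    (φ : ℕ → StrongDual ℝ X) {C : ℝ} (hC : ∀ n, ‖φ n‖ ≤ C)
    (hφ : ∀ x, ∃ l, Tendsto (fun n => φ n x) atTop (𝓝 l)) :
    ∃ T : X →L[ℝ] spaceC, (∀ x n, (T x : lp (fun _ : ℕ => ℝ) ∞) n = φ n x) ∧ ‖T‖ ≤ C := by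
  have hC0 : 0 ≤ C := (norm_nonneg _).trans (hC 0)
  have hb : ∀ x n, ‖φ n x‖ ≤ C * ‖x‖ := fun x n => (φ n).le_of_opNorm_le (hC n) x
  let T₀ : X →ₗ[ℝ] spaceC :=
    { toFun := fun x => ⟨⟨fun n => φ n x, memℓp_infty ⟨C * ‖x‖, by
        rintro _ ⟨n, rfl⟩
        exact hb x n⟩⟩, hφ x⟩
      map_add' := fun x y => by
        ext n
        exact (φ n).map_add x y
      map_smul' := fun r x => by
        ext n
        exact (φ n).map_smul r x }
  have hT₀ : ∀ x, ‖T₀ x‖ ≤ C * ‖x‖ := fun x =>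
    lp.norm_le_of_forall_le (by positivity) (hb x)
  exact ⟨T₀.mkContinuous C hT₀, fun x n => rfl, T₀.mkContinuous_norm_le hC0 hT₀⟩

/-- An element of `ℓ∞` whose coordinates are all below `1` in absolute value, and eventually below
some `r < 1`, has norm below `1`. -/
theorem norm_lt_one_of_eventually_le {y : lp (fun _ : ℕ => ℝ) ∞} {r : ℝ} (hr0 : 0 ≤ r)
    (hr : r < 1) (hy : ∀ n, ‖y n‖ < 1) (hev : ∀ᶠ n in atTop, ‖y n‖ ≤ r) : ‖y‖ < 1 := by
  obtain ⟨N, hN⟩ := eventually_atTop.1 hev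
  suffices ∃ C : ℝ, 0 ≤ C ∧ C < 1 ∧ ∀ n < N, ‖y n‖ ≤ C by
    obtain ⟨C, hC0, hC1, hC⟩ := this
    refine (lp.norm_le_of_forall_le (C := max r C) (le_max_of_le_left hr0) fun n => ?_).trans_lt
      (max_lt hr hC1)
    rcases lt_or_ge n N with h | h
    · exact le_max_of_le_right (hC n h)
    · exact le_max_of_le_left (hN n h)
  clear hN
  induction N with
  | zero => exact ⟨0, le_rfl, one_pos, by simp⟩
  | succ N ih =>
    obtain ⟨C, hC0, hC1, hC⟩ := ih
    refine ⟨max C ‖y N‖, le_max_of_le_left hC0, max_lt hC1 (hy N), fun n hn => ?_⟩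
    rcases Nat.lt_succ_iff_lt_or_eq.1 hn with h | rfl
    · exact le_max_of_le_left (hC n h)
    · exact le_max_right _ _

/-- Some operator into `c` is perturbed by a rank-one operator to one of larger norm which does not
attain it. -/
theorem exists_rank_one_perturbation_not_normAttains {X : Type*} [NormedAddCommGroup X]
    [NormedSpace ℝ X] (hinf : ¬ FiniteDimensional ℝ X) (hrefl : IsReflexiveSpace X) :
    ∃ (S : X →L[ℝ] spaceC) (f : StrongDual ℝ X) (y : spaceC),
      ‖S‖ < ‖S + f.smulRight y‖ ∧ ¬ NormAttains (S + f.smulRight y) := by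
  obtain ⟨f, e, q, L, hf1, he1, he0, hq, hqn, hL⟩ := hrefl.exists_add_null_seq hinf
  have hq0 : 0 < q := by linarith
  have hqL : q ≤ L := ge_of_tendsto' hL hqn
  have hL0 : 0 < L := by linarith
  set a : ℕ → ℝ := fun n => 1 - 1 / ((n : ℝ) + 1)
  have ha0 : ∀ n, 0 ≤ a n := fun n => by
    have : 1 / ((n : ℝ) + 1) ≤ 1 := by
      rw [div_le_one (by positivity)]
      linarith [n.cast_nonneg (α := ℝ)]
    simp only [a]
    linarith
  have ha1 : ∀ n, a n < 1 := fun n => by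
    have : 0 < 1 / ((n : ℝ) + 1) := by positivity
    simp only [a]
    linarith
  have ha : Tendsto a atTop (𝓝 1) := by
    simpa only [sub_zero] using (tendsto_one_div_add_atTop_nhds_zero_nat (𝕜 := ℝ)).const_sub 1
  set t : ℕ → ℝ := fun n => a n / ‖f + e n‖
  have hpos : ∀ n, 0 < ‖f + e n‖ := fun n => by linarith [hqn n]
  have ht0 : ∀ n, 0 ≤ t n := fun n => div_nonneg (ha0 n) (norm_nonneg _)
  have ht : Tendsto t atTop (𝓝 (1 / L)) := ha.div hL hL0.ne'
  have htq : ∀ n, t n ≤ 1 / q := fun n => div_le_div₀ zero_le_one (ha1 n).le hq0 (hqn n)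
  have hte : ∀ x, Tendsto (fun n => t n * e n x) atTop (𝓝 0) := fun x => by
    simpa using ht.mul (he0 x)
  obtain ⟨S, hS, hSn⟩ := exists_clm_spaceC (fun n => t n • e n) (C := 1 / q)
    (fun n => by
      rw [norm_smul, he1, mul_one, Real.norm_of_nonneg (ht0 n)]
      exact htq n)
    (fun x => ⟨0, by simpa using hte x⟩)
  let y : spaceC := ⟨⟨t, memℓp_infty ⟨1 / q, by
    rintro _ ⟨n, rfl⟩
    simpa only [Real.norm_of_nonneg (ht0 n)] using htq n⟩⟩, 1 / L, ht⟩
  set T := S + f.smulRight y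
  have hT : ∀ x n, (T x : lp (fun _ : ℕ => ℝ) ∞) n = t n * (f + e n) x := by
    intro x n
    have h1 : (T x : lp (fun _ : ℕ => ℝ) ∞) n = (S x : lp (fun _ : ℕ => ℝ) ∞) n + f x * t n := rfl
    rw [h1, hS]
    simp only [smul_apply, add_apply, smul_eq_mul]
    ring
  have hnorm : ∀ n, ‖t n • (f + e n)‖ = a n := fun n => by
    rw [norm_smul, Real.norm_of_nonneg (ht0 n), div_mul_cancel₀ _ (hpos n).ne']
  have hTn : 1 ≤ ‖T‖ := by
    refine le_of_tendsto' ha fun n => ?_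
    rw [← hnorm n]
    refine ContinuousLinearMap.opNorm_le_bound _ (norm_nonneg T) fun x => ?_
    refine le_trans ?_ (T.le_opNorm x)
    rw [smul_apply, smul_eq_mul, ← hT]
    exact lp.norm_apply_le_norm ENNReal.top_ne_zero _ n
  have hq1 : 1 / q < 1 := by rwa [div_lt_one hq0]
  refine ⟨S, f, y, (hSn.trans_lt hq1).trans_le hTn, ?_⟩
  rintro ⟨x, hx, hxT⟩
  obtain ⟨r, hr1, hr2⟩ := exists_between hq1
  have hr0 : 0 ≤ r := by
    have : 0 < 1 / q := by positivity
    linarith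
  refine absurd hxT (ne_of_lt (lt_of_lt_of_le ?_ hTn))
  refine norm_lt_one_of_eventually_le (y := (T x : lp (fun _ : ℕ => ℝ) ∞)) hr0 hr2
    (fun n => ?_) ?_
  · rw [hT]
    refine lt_of_le_of_lt ?_ (ha1 n)
    simpa only [mul_one, smul_apply, smul_eq_mul] using
      (t n • (f + e n)).le_of_opNorm_le_of_le (hnorm n).le hx
  · have hlim : Tendsto (fun n => ‖(T x : lp (fun _ : ℕ => ℝ) ∞) n‖) atTop (𝓝 ‖1 / L * f x‖) := by
      simp only [hT]
      have := (ht.mul ((he0 x).const_add (f x))).norm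
      simpa using this
    refine (hlim.eventually (gt_mem_nhds (lt_of_le_of_lt ?_ hr1))).mono fun n hn => le_of_lt hn
    have hfx : ‖f x‖ ≤ 1 := by simpa using f.le_of_opNorm_le_of_le hf1 hx
    rw [norm_mul, Real.norm_of_nonneg (by positivity)]
    calc 1 / L * ‖f x‖ ≤ 1 / q * 1 := by gcongr
      _ = 1 / q := mul_one _

theorem fail_CPP_into_c
    (X : Type*) [NormedAddCommGroup X] [NormedSpace ℝ X] [CompleteSpace X]
    (hinf : ¬ FiniteDimensional ℝ X) (hrefl : IsReflexiveSpace X) :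
    (∃ S R : X →L[ℝ] spaceC,
      Module.rank ℝ (LinearMap.range (R : X →ₗ[ℝ] spaceC)) ≤ 1 ∧
      ‖S‖ < ‖S + R‖ ∧ ¬ NormAttains (S + R)) ∧
    ¬ CPP X spaceC := by
  obtain ⟨S, f, y, hlt, hna⟩ := exists_rank_one_perturbation_not_normAttains hinf hrefl
  refine ⟨⟨S, f.smulRight y, ?_, hlt, hna⟩, fun hcpp => hna (hcpp _ _ ?_ hlt)⟩
  · have hle : LinearMap.range (f.smulRight y : X →ₗ[ℝ] spaceC) ≤ Submodule.span ℝ {y} := by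
      rintro _ ⟨x, rfl⟩
      exact Submodule.smul_mem _ _ (Submodule.mem_span_singleton_self y)
    exact (Submodule.rank_mono hle).trans ((rank_span_le _).trans (by simp))
  · exact (isCompactOperator_of_locallyCompactSpace_dom f).clm_comp
      ((ContinuousLinearMap.id ℝ ℝ).smulRight y)
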